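/- Let M be the 3m×2m block matrix M = [[N_L, 0],[N_U, N_L],[0, N_U]] and set H = T · M (an m×2m matrix). For 1 ≤ i ≤ m+1, let H_i be the m×m submatrix of H consisting of its m consecutive columns i, …, i+m−1. Then for every i with 1 ≤ i ≤ m+1, the matrix B_{m−i+2} is invertible and H_i = (B_{m−i+2})⁻¹. -/

import Mathlib

open Matrix

noncomputable section

/-- Lower triangular Toeplitz m×m matrix: entry (i,j) equals `a (i-j)` (0-based),
i.e. `a_{i-j+1}` in the 1-based notation of the paper, for j ≤ i, and 0 otherwise. -/
def lowT (m : ℕ) (a : Fin (m + 1) → ℝ) : Matrix (Fin m) (Fin m) ℝ :=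
  fun i j =>
    if h : (j : ℕ) ≤ (i : ℕ) then a ⟨(i : ℕ) - (j : ℕ), by have := i.2; omega⟩ else 0

/-- Upper triangular Toeplitz m×m matrix: entry (i,j) equals `a (m + i - j)` (0-based),
i.e. `a_{m+1+i-j}` in the 1-based notation of the paper, for i ≤ j, and 0 otherwise. -/
def upT (m : ℕ) (a : Fin (m + 1) → ℝ) : Matrix (Fin m) (Fin m) ℝ :=
  fun i j =>
    if h : (i : ℕ) ≤ (j : ℕ) then a ⟨m + (i : ℕ) - (j : ℕ), by have := j.2; omega⟩ else 0

/-- The 2m×2m Sylvester matrix S = [[D_L, N_L],[D_U, N_U]]. -/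
def sylv (m : ℕ) (d n : Fin (m + 1) → ℝ) : Matrix (Fin (m + m)) (Fin (m + m)) ℝ :=
  (fromBlocks (lowT m d) (lowT m n) (upT m d) (upT m n)).submatrix
    finSumFinEquiv.symm finSumFinEquiv.symm

/-- The 2m×2m lower triangular matrix D = [[D_L, 0],[D_U, D_L]]. -/
def dMat (m : ℕ) (d : Fin (m + 1) → ℝ) : Matrix (Fin (m + m)) (Fin (m + m)) ℝ :=
  (fromBlocks (lowT m d) (0 : Matrix (Fin m) (Fin m) ℝ) (upT m d) (lowT m d)).submatrix
    finSumFinEquiv.symm finSumFinEquiv.symm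

/-- The m×2m matrix formed by the last m rows of a 2m×2m matrix. -/
def lastRows (m : ℕ) (M : Matrix (Fin (m + m)) (Fin (m + m)) ℝ) :
    Matrix (Fin m) (Fin (m + m)) ℝ :=
  fun i j => M ⟨m + (i : ℕ), by have := i.2; omega⟩ j

/-- The m×m submatrix of an m×2m matrix consisting of the m consecutive columns
starting from column i (0-based; column i+1 in the 1-based notation of the paper). -/
def subCols (m : ℕ) (M : Matrix (Fin m) (Fin (m + m)) ℝ) (i : Fin (m + 1)) :
    Matrix (Fin m) (Fin m) ℝ :=
  fun r c => M r ⟨(i : ℕ) + (c : ℕ), by have := i.2; have := c.2; omega⟩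

/-- The kernel T = ( -D_U·D_L⁻¹ | I_m | -D_L·D_U⁻¹ ), an m×3m matrix. -/
def kerT (m : ℕ) (d : Fin (m + 1) → ℝ) : Matrix (Fin m) (Fin (m + m + m)) ℝ :=
  (fromCols
      (fromCols (-(upT m d * (lowT m d)⁻¹)) (1 : Matrix (Fin m) (Fin m) ℝ))
      (-(lowT m d * (upT m d)⁻¹))).submatrix id
    (((Equiv.sumCongr finSumFinEquiv (Equiv.refl (Fin m))).trans finSumFinEquiv).symm)

/-- T_i : the m×2m submatrix of T consisting of the 2m consecutive columns
starting from column i (0-based). -/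
def tSub (m : ℕ) (d : Fin (m + 1) → ℝ) (i : Fin (m + 1)) :
    Matrix (Fin m) (Fin (m + m)) ℝ :=
  fun r c => kerT m d r ⟨(i : ℕ) + (c : ℕ), by have := i.2; have := c.2; omega⟩

/-- T_{i,j} : the m×m submatrix of T_i consisting of the m consecutive columns
starting from column j (0-based). -/
def tSub2 (m : ℕ) (d : Fin (m + 1) → ℝ) (i j : Fin (m + 1)) :
    Matrix (Fin m) (Fin m) ℝ :=
  fun r c =>
    kerT m d r ⟨(i : ℕ) + (j : ℕ) + (c : ℕ), by have := i.2; have := j.2; have := c.2; omega⟩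

/-- The 2m×m block column matrix [D_L; D_U]. -/
def dlMat (m : ℕ) (d : Fin (m + 1) → ℝ) : Matrix (Fin (m + m)) (Fin m) ℝ :=
  (fromRows (lowT m d) (upT m d)).submatrix finSumFinEquiv.symm id

/-- The 2m×m block column matrix [0; D_L]. -/
def drMat (m : ℕ) (d : Fin (m + 1) → ℝ) : Matrix (Fin (m + m)) (Fin m) ℝ :=
  (fromRows (0 : Matrix (Fin m) (Fin m) ℝ) (lowT m d)).submatrix finSumFinEquiv.symm id

/-- The 2m×m block column matrix [N_L; N_U]. -/
def nMat (m : ℕ) (n : Fin (m + 1) → ℝ) : Matrix (Fin (m + m)) (Fin m) ℝ :=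
  (fromRows (lowT m n) (upT m n)).submatrix finSumFinEquiv.symm id

/-- The 3m×2m block matrix [[X_L, 0],[X_U, X_L],[0, X_U]] built from the
lower/upper triangular Toeplitz matrices of a. -/
def kMat (m : ℕ) (a : Fin (m + 1) → ℝ) : Matrix (Fin (m + m + m)) (Fin (m + m)) ℝ :=
  (fromRows
      (fromRows (fromCols (lowT m a) (0 : Matrix (Fin m) (Fin m) ℝ))
        (fromCols (upT m a) (lowT m a)))
      (fromCols (0 : Matrix (Fin m) (Fin m) ℝ) (upT m a))).submatrix
    (((Equiv.sumCongr finSumFinEquiv (Equiv.refl (Fin m))).trans finSumFinEquiv).symm)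
    finSumFinEquiv.symm

/-- Index reversal i ↦ m - i on 0-based indices, corresponding to the 1-based
index map i ↦ m - i + 2 of the paper. -/
def revIdx (m : ℕ) (i : Fin (m + 1)) : Fin (m + 1) := ⟨m - (i : ℕ), by omega⟩

theorem isUnit_det_lowT (m : ℕ) (d : Fin (m + 1) → ℝ) (h : d 0 ≠ 0) :
    IsUnit (lowT m d).det := by
  rw [det_of_isLowerTriangular _ fun i j hij => by
    exact dif_neg (not_le.mpr (show (i : ℕ) < j from hij))]
  rw [isUnit_iff_ne_zero, Finset.prod_ne_zero_iff]
  intro i _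
  simpa [lowT] using h

theorem isUnit_det_upT (m : ℕ) (d : Fin (m + 1) → ℝ) (h : d (Fin.last m) ≠ 0) :
    IsUnit (upT m d).det := by
  rw [det_of_isUpperTriangular fun i j hij => by
    exact dif_neg (not_le.mpr (show (j : ℕ) < i from hij))]
  rw [isUnit_iff_ne_zero, Finset.prod_ne_zero_iff]
  intro i _
  simpa [upT, Fin.last] using h

/-- `kerT` annihilates the convolution matrix of `d`. -/
theorem kerT_mul_kMat_self (m : ℕ) (d : Fin (m + 1) → ℝ) (h₀ : d 0 ≠ 0)
    (h₁ : d (Fin.last m) ≠ 0) : kerT m d * kMat m d = 0 := by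
  rw [kerT, kMat, submatrix_mul_equiv, fromCols_mul_fromRows, fromCols_mul_fromRows]
  simp only [mul_fromCols, neg_mul, one_mul, mul_zero,
    nonsing_inv_mul_cancel_right _ _ (isUnit_det_lowT m d h₀),
    nonsing_inv_mul_cancel_right _ _ (isUnit_det_upT m d h₁)]
  ext i j
  rcases h : finSumFinEquiv.symm j with k | k <;> simp [h]

theorem dlMat_apply (m : ℕ) (a : Fin (m + 1) → ℝ) (k : Fin (m + m)) (c : Fin m) :
    dlMat m a k c =
      if h : (c : ℕ) ≤ k ∧ (k : ℕ) ≤ c + m then a ⟨k - c, by omega⟩ else 0 := by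
  refine Fin.addCases (fun k => ?_) (fun k => ?_) k
  · simp only [dlMat, submatrix_apply, finSumFinEquiv_symm_apply_castAdd, fromRows_apply_inl, lowT,
      id, Fin.val_castAdd]
    grind
  · simp only [dlMat, submatrix_apply, finSumFinEquiv_symm_apply_natAdd, fromRows_apply_inr, upT,
      id, Fin.val_natAdd]
    grind

theorem kMat_apply (m : ℕ) (a : Fin (m + 1) → ℝ) (k : Fin (m + m + m)) (c : Fin (m + m)) :
    kMat m a k c =
      if h : (c : ℕ) ≤ k ∧ (k : ℕ) ≤ c + m then a ⟨k - c, by omega⟩ else 0 := by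
  refine Fin.addCases (fun k => Fin.addCases (fun k => ?_) (fun k => ?_) k) (fun k => ?_) k <;>
  refine Fin.addCases (fun c => ?_) (fun c => ?_) c <;>
  · simp only [kMat, submatrix_apply, Equiv.symm_trans_apply, Equiv.sumCongr_symm,
      Equiv.sumCongr_apply, Sum.map_inl, Sum.map_inr, Equiv.refl_symm, Equiv.refl_apply,
      finSumFinEquiv_symm_apply_castAdd, finSumFinEquiv_symm_apply_natAdd,
      fromRows_apply_inl, fromRows_apply_inr, fromCols_apply_inl, fromCols_apply_inr,
      lowT, upT, Matrix.zero_apply, Fin.val_castAdd, Fin.val_natAdd]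
    grind

theorem subCols_kerT_mul_kMat (m : ℕ) (d a : Fin (m + 1) → ℝ) (i : Fin (m + 1)) :
    subCols m (kerT m d * kMat m a) i = tSub m d i * dlMat m a := by
  ext r c
  simp only [subCols, tSub, mul_apply]
  symm
  refine Fintype.sum_of_injective
    (fun k : Fin (m + m) => (⟨i + k, by omega⟩ : Fin (m + m + m))) ?_ _ _ ?_ ?_
  · intro x y hxy
    simpa [Fin.ext_iff] using hxy
  · intro k hk
    rw [kMat_apply, dif_neg, mul_zero]
    rintro ⟨h₁, h₂⟩
    simp only at h₁ h₂
    exact hk ⟨⟨k - i, by omega⟩, by ext; simp; omega⟩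
  · intro k
    simp only [kMat_apply, dlMat_apply]
    grind

/-- The middle block of `kerT` is the identity. -/
theorem subCols_tSub_revIdx (m : ℕ) (d : Fin (m + 1) → ℝ) (i : Fin (m + 1)) :
    subCols m (tSub m d i) (revIdx m i) = 1 := by
  ext r c
  have h : (⟨i + (revIdx m i + c), by simp only [revIdx]; omega⟩ : Fin (m + m + m)) =
      Fin.castAdd m (Fin.natAdd m c) := by
    ext
    simp only [revIdx, Fin.val_castAdd, Fin.val_natAdd]
    omega
  simp only [subCols, tSub, h]
  simp only [kerT, submatrix_apply, id, Equiv.symm_trans_apply, Equiv.sumCongr_symm,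
    Equiv.sumCongr_apply, finSumFinEquiv_symm_apply_castAdd, Sum.map_inl, fromCols_apply_inl,
    finSumFinEquiv_symm_apply_natAdd, fromCols_apply_inr]

theorem mul_sylv (m : ℕ) (d n : Fin (m + 1) → ℝ) (A : Matrix (Fin m) (Fin (m + m)) ℝ) :
    A * sylv m d n =
      (fromCols (A * dlMat m d) (A * dlMat m n)).submatrix id finSumFinEquiv.symm := by
  ext r c
  refine Fin.addCases (fun c => ?_) (fun c => ?_) c <;>
  · simp only [mul_apply, submatrix_apply, sylv, dlMat, id, finSumFinEquiv_symm_apply_castAdd,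
      finSumFinEquiv_symm_apply_natAdd, fromCols_apply_inl, fromCols_apply_inr]
    refine Finset.sum_congr rfl fun k _ => ?_
    rcases finSumFinEquiv.symm k with k | k <;> simp

theorem fromCols_zero_mul (m : ℕ) (H : Matrix (Fin m) (Fin m) ℝ)
    (B : Matrix (Fin (m + m)) (Fin (m + m)) ℝ) :
    (fromCols (0 : Matrix (Fin m) (Fin m) ℝ) H).submatrix id finSumFinEquiv.symm * B =
      H * lastRows m B := by
  ext r c
  simp only [mul_apply, Fin.sum_univ_add]
  simp only [submatrix_apply, id, finSumFinEquiv_symm_apply_castAdd, fromCols_apply_inl,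
    finSumFinEquiv_symm_apply_natAdd, fromCols_apply_inr, Matrix.zero_apply, zero_mul,
    Finset.sum_const_zero, zero_add]
  rfl

theorem H_cols_eq_inv (m : ℕ) (hm : 1 ≤ m) (d n : Fin (m + 1) → ℝ) (hd : ∀ k, d k ≠ 0) (hn : ∀ k, n k ≠ 0)
    (hS : IsUnit (sylv m d n)) (hD : IsUnit (dMat m d)) :
    ∀ i : Fin (m + 1),
      IsUnit (subCols m (lastRows m (sylv m d n)⁻¹) (revIdx m i)) ∧
        subCols m (kerT m d * kMat m n) i = (subCols m (lastRows m (sylv m d n)⁻¹) (revIdx m i))⁻¹ := by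
  intro i
  have hzero : tSub m d i * dlMat m d = 0 := by
    rw [← subCols_kerT_mul_kMat, kerT_mul_kMat_self m d (hd _) (hd _)]
    rfl
  have hT : tSub m d i = (tSub m d i * dlMat m n) * lastRows m (sylv m d n)⁻¹ := by
    rw [← fromCols_zero_mul, ← hzero, ← mul_sylv,
      mul_nonsing_inv_cancel_right _ _ ((isUnit_iff_isUnit_det _).mp hS)]
  have hone : (tSub m d i * dlMat m n) *
      subCols m (lastRows m (sylv m d n)⁻¹) (revIdx m i) = 1 := by
    rw [← subCols_tSub_revIdx m d i]
    conv_rhs => rw [hT]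
    rfl
  rw [subCols_kerT_mul_kMat]
  exact ⟨.of_mul_eq_one_right _ hone, (inv_eq_left_inv hone).symm⟩
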